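/- arXiv:2010.09597 — 2 statements merged into one kernel-verified Lean document; each statement's English description precedes it below -/
import Mathlib

section
/- Let f be continuously differentiable, (m,b)-dissipative, and L-smooth with m ≤ L, let x* be a global minimizer of f, and let π be the probability measure on ℝ^d with density proportional to e^{−βf(x)}. For ε ∈ (0,1), set R = R̄(ε/12), let Ω = B(0,R), and let π* be the truncated target distribution, i.e., the probability measure with density proportional to e^{−βf(x)}·1{x ∈ Ω}. Then ‖π* − π‖_TV ≤ ε/4. -/
open MeasureTheory
open scoped InnerProductSpace

/-- The radius `R̄(z)` from the paper. -/
noncomputable def Rbar (m b βv L : ℝ) (d : ℕ) (z : ℝ) : ℝ :=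
  Real.sqrt (max (625 * d * Real.log (4 / z) / (m * βv))
    (max ((4 * d * Real.log (4 * L / m) + 4 * βv * b) / (m * βv))
      ((4 * d + 8 * Real.sqrt (d * Real.log (1 / z)) + 8 * Real.log (1 / z)) / (m * βv))))

/-- Evaluating a measure with a normalised nonnegative density. -/
theorem toReal_withDensity_ofReal_div {α : Type*} [MeasurableSpace α] {μ : Measure α}
    {h : α → ℝ} (hh : Integrable h μ) (h0 : ∀ x, 0 ≤ h x) {c : ℝ} (hc : 0 ≤ c)
    {A : Set α} (hA : MeasurableSet A) :
    ((μ.withDensity fun x => ENNReal.ofReal (h x / c)) A).toReal = (∫ x in A, h x ∂μ) / c := by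
  rw [withDensity_apply _ hA, ← integral_div, integral_eq_lintegral_of_nonneg_ae]
  · exact Filter.Eventually.of_forall fun x => div_nonneg (h0 x) hc
  · exact (hh.div_const c).aestronglyMeasurable.restrict

/-- Truncating a probability density to a set missing at most mass `δ` moves the probability of
any event by at most `δ`. -/
theorem abs_truncated_sub_le {α : Type*} [MeasurableSpace α] {μ : Measure α}
    {h : α → ℝ} (hh : Integrable h μ) (h0 : ∀ x, 0 ≤ h x) {A Ω : Set α}
    (hA : MeasurableSet A) (hΩ : MeasurableSet Ω) {δ : ℝ} (hZ : 0 < ∫ x, h x ∂μ)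
    (hδ1 : δ < 1) (htail : ∫ x in Ωᶜ, h x ∂μ ≤ δ * ∫ x, h x ∂μ) :
    |(∫ x in A ∩ Ω, h x ∂μ) / (∫ x in Ω, h x ∂μ) - (∫ x in A, h x ∂μ) / ∫ x, h x ∂μ| ≤ δ := by
  have hsplit := integral_add_compl hΩ hh
  have hAsplit := integral_inter_add_sdiff (s := A) hΩ hh.integrableOn
  have hin : ∫ x in A ∩ Ω, h x ∂μ ≤ ∫ x in Ω, h x ∂μ :=
    setIntegral_mono_set hh.integrableOn (Filter.Eventually.of_forall h0)
      (Filter.Eventually.of_forall Set.inter_subset_right)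
  have hout : ∫ x in A \ Ω, h x ∂μ ≤ ∫ x in Ωᶜ, h x ∂μ :=
    setIntegral_mono_set hh.integrableOn (Filter.Eventually.of_forall h0)
      (Filter.Eventually.of_forall fun _ hx => hx.2)
  have hin0 : 0 ≤ ∫ x in A ∩ Ω, h x ∂μ := setIntegral_nonneg (hA.inter hΩ) fun x _ => h0 x
  have hout0 : 0 ≤ ∫ x in A \ Ω, h x ∂μ := setIntegral_nonneg (hA.diff hΩ) fun x _ => h0 x
  rw [← hAsplit]
  generalize (∫ x in A ∩ Ω, h x ∂μ) = p at *
  generalize (∫ x in A \ Ω, h x ∂μ) = q at *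
  generalize (∫ x in Ω, h x ∂μ) = w at *
  generalize (∫ x in Ωᶜ, h x ∂μ) = r at *
  generalize (∫ x, h x ∂μ) = Z at *
  have hw : 0 < w := by nlinarith
  have hkey : p / w - (p + q) / Z = (p / w) * (r / Z) - q / Z := by
    rw [← hsplit] at hZ ⊢
    field_simp
    ring
  have hr : r / Z ≤ δ := (div_le_iff₀ hZ).2 htail
  have hr0 : 0 ≤ r / Z := div_nonneg (hout0.trans hout) hZ.le
  have hpw0 : 0 ≤ p / w := div_nonneg hin0 hw.le
  have hpw1 : p / w ≤ 1 := (div_le_one hw).2 hin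
  have hq0 : 0 ≤ q / Z := div_nonneg hout0 hZ.le
  have hq : q / Z ≤ r / Z := div_le_div_of_nonneg_right hout hZ.le
  rw [hkey, abs_le]
  constructor <;> nlinarith

theorem integrable_exp_neg_mul_norm_sq {E : Type*} [NormedAddCommGroup E] [InnerProductSpace ℝ E]
    [FiniteDimensional ℝ E] [MeasurableSpace E] [BorelSpace E] {c : ℝ} (hc : 0 < c) :
    Integrable fun x : E => Real.exp (-c * ‖x‖ ^ 2) := by
  have h := (GaussianFourier.integrable_cexp_neg_mul_sq_norm_add (V := E) (b := (c : ℂ))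
    (by simpa using hc) 0 0).norm
  refine h.congr (Filter.Eventually.of_forall fun x => ?_)
  simp [Complex.norm_exp, ← Complex.ofReal_pow]

section Dissipative

variable {E : Type*} [NormedAddCommGroup E] [InnerProductSpace ℝ E] [CompleteSpace E]
  {f : E → ℝ} {m b : ℝ}

/-- Growth of a dissipative function along the ray from `x / 2` to `x`. -/
theorem dissipative_half_growth (hf : Differentiable ℝ f)
    (hdiss : ∀ x : E, m * ‖x‖ ^ 2 - b ≤ ⟪gradient f x, x⟫_ℝ) (x : E) :
    f ((1 / 2 : ℝ) • x) + 3 / 8 * m * ‖x‖ ^ 2 - b * Real.log 2 ≤ f x := by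
  let g : ℝ → ℝ := fun t => f (t • x) - m / 2 * ‖x‖ ^ 2 * t ^ 2 + b * Real.log t
  have hder : ∀ t : ℝ, 0 < t → HasDerivAt g
      (⟪gradient f (t • x), x⟫_ℝ - m / 2 * ‖x‖ ^ 2 * (2 * t) + b * t⁻¹) t := by
    intro t ht
    have h1 : HasDerivAt (fun s : ℝ => s • x) x t := by
      simpa using (hasDerivAt_id t).smul_const x
    have h2 := (hf (t • x)).hasGradientAt.hasFDerivAt.comp_hasDerivAt t h1
    have h3 : HasDerivAt (fun s : ℝ => s ^ 2) (2 * t) t := by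
      simpa using hasDerivAt_pow 2 t
    have h4 := (h2.sub (h3.const_mul (m / 2 * ‖x‖ ^ 2))).add
      ((Real.hasDerivAt_log ht.ne').const_mul b)
    exact h4
  have hmono : MonotoneOn g (Set.Icc (1 / 2) 1) := by
    refine monotoneOn_of_hasDerivWithinAt_nonneg (convex_Icc _ _)
      (f' := fun t => ⟪gradient f (t • x), x⟫_ℝ - m / 2 * ‖x‖ ^ 2 * (2 * t) + b * t⁻¹)
      ?_ ?_ ?_
    · intro t ht
      exact (hder t (by linarith [ht.1])).continuousAt.continuousWithinAt
    · intro t ht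
      rw [interior_Icc] at ht
      exact (hder t (by linarith [ht.1])).hasDerivWithinAt
    · intro t ht
      rw [interior_Icc] at ht
      have ht0 : 0 < t := by linarith [ht.1]
      have h := hdiss (t • x)
      rw [inner_smul_right, norm_smul, mul_pow, Real.norm_eq_abs, sq_abs] at h
      have : ⟪gradient f (t • x), x⟫_ℝ - m / 2 * ‖x‖ ^ 2 * (2 * t) + b * t⁻¹ =
          (t * ⟪gradient f (t • x), x⟫_ℝ - (m * (t ^ 2 * ‖x‖ ^ 2) - b)) / t := by
        field_simp
        ring
      rw [this]
      exact div_nonneg (by linarith) ht0.le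
  have h := hmono (Set.left_mem_Icc.2 (by norm_num)) (Set.right_mem_Icc.2 (by norm_num))
    (by norm_num : (1 / 2 : ℝ) ≤ 1)
  have hlog : Real.log (1 / 2) = -Real.log 2 := by rw [one_div, Real.log_inv]
  simp only [g, hlog, Real.log_one, one_smul] at h
  linarith

variable [FiniteDimensional ℝ E] [MeasurableSpace E] [BorelSpace E]

/-- A dissipative function which is bounded below has an integrable Gibbs density. -/
theorem dissipative_integrable_exp {β M : ℝ} (hm : 0 < m) (hβ : 0 < β)
    (hf : Differentiable ℝ f) (hdiss : ∀ x : E, m * ‖x‖ ^ 2 - b ≤ ⟪gradient f x, x⟫_ℝ)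
    (hM : ∀ x, M ≤ f x) : Integrable fun x => Real.exp (-β * f x) := by
  have hg := (integrable_exp_neg_mul_norm_sq (E := E) (c := β * (3 / 8 * m))
    (by positivity)).const_mul (Real.exp (-β * (M - b * Real.log 2)))
  refine hg.mono' ?_ (Filter.Eventually.of_forall fun x => ?_)
  · exact (Real.continuous_exp.comp (continuous_const.mul hf.continuous)).aestronglyMeasurable
  · rw [Real.norm_eq_abs, Real.abs_exp, ← Real.exp_add, Real.exp_le_exp]
    have h := dissipative_half_growth hf hdiss x
    have h' := mul_le_mul_of_nonneg_left
      (show M + 3 / 8 * m * ‖x‖ ^ 2 - b * Real.log 2 ≤ f x by linarith [hM ((1 / 2 : ℝ) • x)])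
      hβ.le
    linarith

/-- Gaussian tail bound for the Gibbs density of a dissipative function. -/
theorem dissipative_tail_le {β R : ℝ} (hm : 0 < m) (hβ : 0 < β) (hR : 0 ≤ R)
    (hf : Differentiable ℝ f) (hdiss : ∀ x : E, m * ‖x‖ ^ 2 - b ≤ ⟪gradient f x, x⟫_ℝ)
    (hint : Integrable fun x => Real.exp (-β * f x)) :
    ∫ x in (Metric.closedBall (0 : E) R)ᶜ, Real.exp (-β * f x) ≤
      Real.exp (Module.finrank ℝ E * Real.log 2 + β * b * Real.log 2
        - 3 / 8 * (m * β) * R ^ 2) * ∫ x, Real.exp (-β * f x) := by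
  have hint' : Integrable fun x : E => Real.exp (-β * f ((1 / 2 : ℝ) • x)) :=
    hint.comp_smul (by norm_num)
  have hscale := Measure.integral_comp_smul (volume : Measure E)
    (fun x => Real.exp (-β * f x)) (1 / 2 : ℝ)
  set C := Real.exp (β * b * Real.log 2 - 3 / 8 * (m * β) * R ^ 2) with hC
  calc ∫ x in (Metric.closedBall (0 : E) R)ᶜ, Real.exp (-β * f x)
      ≤ ∫ x in (Metric.closedBall (0 : E) R)ᶜ, C * Real.exp (-β * f ((1 / 2 : ℝ) • x)) := by
        refine setIntegral_mono_on hint.integrableOn (hint'.const_mul C).integrableOn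
          Metric.isClosed_closedBall.measurableSet.compl fun x hx => ?_
        rw [hC, ← Real.exp_add, Real.exp_le_exp]
        have hx' : R ≤ ‖x‖ := by
          have : ¬ ‖x‖ ≤ R := by simpa using hx
          linarith
        have h := mul_le_mul_of_nonneg_left (dissipative_half_growth hf hdiss x) hβ.le
        have h2 : R ^ 2 ≤ ‖x‖ ^ 2 := by gcongr
        have h3 := mul_le_mul_of_nonneg_left h2 (mul_pos hm hβ).le
        linarith
    _ ≤ ∫ x, C * Real.exp (-β * f ((1 / 2 : ℝ) • x)) :=
        setIntegral_le_integral (hint'.const_mul C)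
          (Filter.Eventually.of_forall fun x => by positivity)
    _ = _ := by
        have h2 : |((1 / 2 : ℝ) ^ Module.finrank ℝ E)⁻¹| =
            Real.exp (Module.finrank ℝ E * Real.log 2) := by
          rw [abs_of_nonneg (by positivity), Real.exp_nat_mul, Real.exp_log two_pos, one_div,
            inv_pow, inv_inv]
        rw [integral_const_mul, hscale, smul_eq_mul, h2, hC, ← mul_assoc, ← Real.exp_add]
        congr 2
        ring

end Dissipative

/-- The radius `Rbar` is large enough for the Gaussian tail bound. -/
theorem Rbar_sq_bound {m b β L z : ℝ} (d : ℕ) (hm : 0 < m) (hb : 0 ≤ b) (hβ : 0 < β)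
    (hmL : m ≤ L) (hz : 0 < z) (hz1 : z ≤ 1) :
    d * Real.log 2 + β * b * Real.log 2 - 3 / 8 * (m * β) * Rbar m b β L d z ^ 2 ≤
      Real.log z := by
  have hmβ : 0 < m * β := mul_pos hm hβ
  have hlog4 : Real.log 4 = 2 * Real.log 2 := by
    rw [show (4 : ℝ) = 2 ^ 2 by norm_num, Real.log_pow]
    norm_num
  have hL : 2 * Real.log 2 ≤ Real.log (4 * L / m) := by
    rw [← hlog4]
    refine Real.log_le_log (by norm_num) ?_
    rw [le_div_iff₀ hm]
    linarith
  have hlogz : Real.log (1 / z) = -Real.log z := by rw [one_div, Real.log_inv]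
  have hz0 : Real.log z ≤ 0 := Real.log_nonpos hz.le hz1
  have hd : (0 : ℝ) ≤ d := d.cast_nonneg
  have hl2 := Real.log_two_lt_d9
  have hl2' := Real.log_two_gt_d9
  have hβb : 0 ≤ β * b := by positivity
  have hsqrt := Real.sqrt_nonneg (d * Real.log (1 / z))
  set S := max (625 * d * Real.log (4 / z) / (m * β))
    (max ((4 * d * Real.log (4 * L / m) + 4 * β * b) / (m * β))
      ((4 * d + 8 * Real.sqrt (d * Real.log (1 / z)) + 8 * Real.log (1 / z)) / (m * β)))
  have h2 : (4 * d * Real.log (4 * L / m) + 4 * β * b) / (m * β) ≤ S :=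
    (le_max_left _ _).trans (le_max_right _ _)
  have h3 : (4 * d + 8 * Real.sqrt (d * Real.log (1 / z)) + 8 * Real.log (1 / z)) / (m * β) ≤ S :=
    (le_max_right _ _).trans (le_max_right _ _)
  have hS0 : 0 ≤ S := le_trans (div_nonneg (by rw [hlogz] at *; linarith) hmβ.le) h3
  have hR : Rbar m b β L d z ^ 2 = S := Real.sq_sqrt hS0
  rw [div_le_iff₀ hmβ] at h2 h3
  rw [hlogz] at h3 hsqrt
  have hdL := mul_le_mul_of_nonneg_left hL hd
  have hbl : β * b * Real.log 2 ≤ β * b * (3 / 4) :=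
    mul_le_mul_of_nonneg_left (by linarith) hβb
  have hdl : 0 ≤ d * Real.log 2 := mul_nonneg hd (by linarith)
  rw [hR]
  linarith

theorem statement5 {d : ℕ} (f : EuclideanSpace ℝ (Fin d) → ℝ) (m b L βv : ℝ)
    (hm : 0 < m) (hb : 0 ≤ b) (hβ : 0 < βv) (hmL : m ≤ L) (hf : ContDiff ℝ 1 f)
    (hdiss : ∀ x : EuclideanSpace ℝ (Fin d), m * ‖x‖ ^ 2 - b ≤ ⟪gradient f x, x⟫_ℝ)
    (hsmooth : ∀ x y : EuclideanSpace ℝ (Fin d),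
      ‖gradient f x - gradient f y‖ ≤ L * ‖x - y‖)
    (xstar : EuclideanSpace ℝ (Fin d)) (hmin : ∀ y, f xstar ≤ f y)
    (ε : ℝ) (hε : ε ∈ Set.Ioo (0 : ℝ) 1)
    (R : ℝ) (hR : R = Rbar m b βv L d (ε / 12))
    (Ω : Set (EuclideanSpace ℝ (Fin d)))
    (hΩ : Ω = Metric.closedBall (0 : EuclideanSpace ℝ (Fin d)) R)
    (π πstar : Measure (EuclideanSpace ℝ (Fin d)))
    (hπ : π = volume.withDensity fun x =>
      ENNReal.ofReal (Real.exp (-βv * f x) / ∫ y, Real.exp (-βv * f y)))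
    (hπstar : πstar = volume.withDensity
      (Ω.indicator fun x =>
        ENNReal.ofReal (Real.exp (-βv * f x) / ∫ y in Ω, Real.exp (-βv * f y)))) :
    ∀ A : Set (EuclideanSpace ℝ (Fin d)), MeasurableSet A →
      |(πstar A).toReal - (π A).toReal| ≤ ε / 4 := by
  intro A hA
  obtain ⟨hε0, hε1⟩ := hε
  have hfd : Differentiable ℝ f := hf.differentiable (by norm_num)
  have hint := dissipative_integrable_exp hm hβ hfd hdiss hmin
  have h0 : ∀ x, 0 ≤ Real.exp (-βv * f x) := fun x => (Real.exp_pos _).le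
  have hZ : 0 < ∫ x, Real.exp (-βv * f x) := integral_exp_pos hint
  have hΩm : MeasurableSet Ω := hΩ ▸ Metric.isClosed_closedBall.measurableSet
  have hR0 : 0 ≤ R := hR ▸ Real.sqrt_nonneg _
  have htail : ∫ x in Ωᶜ, Real.exp (-βv * f x) ≤ ε / 12 * ∫ x, Real.exp (-βv * f x) := by
    rw [hΩ]
    refine (dissipative_tail_le hm hβ hR0 hfd hdiss hint).trans ?_
    refine mul_le_mul_of_nonneg_right ?_ hZ.le
    rw [← Real.le_log_iff_exp_le (by positivity), hR, finrank_euclideanSpace_fin]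
    exact Rbar_sq_bound d hm hb hβ hmL (by positivity) (by linarith)
  have hmain := abs_truncated_sub_le hint h0 hA hΩm hZ (by linarith) htail
  rw [hπstar, hπ, withDensity_indicator hΩm,
    toReal_withDensity_ofReal_div hint.restrict h0 (setIntegral_nonneg hΩm fun x _ => h0 x) hA,
    toReal_withDensity_ofReal_div hint h0 hZ.le hA, Measure.restrict_restrict hA]
  linarith
end

section
/- Let T* be a 1/2-lazy, time-reversible Markov kernel on a measurable set Ω ⊆ ℝ^d with stationary probability distribution π*, where π* is atom-free, and let φ denote the conductance of T*. Let T be a 1/2-lazy Markov kernel on Ω that is δ-close to T* with δ ≤ min{1 − √2/2, φ/16}. Let μ₀ be a distribution on Ω and μ_k the distribution after k steps of the chain T. Define h_k(p) := sup{μ_k(A) − π*(A) : A ⊆ Ω measurable with π*(A) = p} for p ∈ [0,1] and Γ_p := min{p, 1−p}. Then for every k ≥ 1 and every measurable A ⊆ Ω with π*(A) = p ∈ (0,1), there exist real numbers φ_k, φ̃_k, φ̂_k satisfying φ_k ≥ φ, 2(1−δ)φ_k ≤ φ̃_k ≤ φ̂_k ≤ 2(1+δ)φ_k, and √(1−φ̃_k)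 + √(1+φ̂_k) ≤ 2(1 − φ_k²/8), such that μ_k(A) − π*(A) ≤ (1/2)h_{k−1}(p − φ̃_k Γ_p) + (1/2)h_{k−1}(p + φ̂_k Γ_p) + 2δφ_k√Γ_p. -/
open MeasureTheory ProbabilityTheory
open scoped ENNReal

/-- The distribution of the Markov chain with transition kernel `T` started from `μ0`,
after `k` steps. -/
noncomputable def chainDist {d : ℕ}
    (T : Kernel (EuclideanSpace ℝ (Fin d)) (EuclideanSpace ℝ (Fin d)))
    (μ0 : Measure (EuclideanSpace ℝ (Fin d))) : ℕ → Measure (EuclideanSpace ℝ (Fin d))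
  | 0 => μ0
  | k + 1 => (chainDist T μ0 k).bind fun u => T u

/-- The conductance of a Markov kernel `T` on `Ω` with stationary distribution `π`. -/
noncomputable def conductance {d : ℕ}
    (T : Kernel (EuclideanSpace ℝ (Fin d)) (EuclideanSpace ℝ (Fin d)))
    (Ω : Set (EuclideanSpace ℝ (Fin d))) (π : Measure (EuclideanSpace ℝ (Fin d))) : ℝ :=
  sInf { r : ℝ | ∃ A : Set (EuclideanSpace ℝ (Fin d)), MeasurableSet A ∧ A ⊆ Ω ∧
    0 < π A ∧ π A < 1 ∧
    r = (∫ u in A, (T u (Ω \ A)).toReal ∂π) / min (π A).toReal (π (Ω \ A)).toReal }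

/-- `h_k(p) = sup { μ_k(A) − π*(A) : A ⊆ Ω measurable, π*(A) = p }`. -/
noncomputable def hGap {d : ℕ} (μk πs : Measure (EuclideanSpace ℝ (Fin d)))
    (Ω : Set (EuclideanSpace ℝ (Fin d))) (p : ℝ) : ℝ :=
  sSup { x : ℝ | ∃ A : Set (EuclideanSpace ℝ (Fin d)), MeasurableSet A ∧ A ⊆ Ω ∧
    (πs A).toReal = p ∧ x = (μk A).toReal - (πs A).toReal }

/-- A quantile of an extended nonnegative function with respect to a finite measure. -/
theorem exists_measure_lt_le_measure_le {X : Type*} [MeasurableSpace X] (ν : Measure X)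
    [IsFiniteMeasure ν] {f : X → ℝ≥0∞} (hf : Measurable f) {q : ℝ≥0∞} (hq : q ≤ ν Set.univ) :
    ∃ c, ν {x | c < f x} ≤ q ∧ q ≤ ν {x | c ≤ f x} := by
  set S : Set ℝ≥0∞ := {t | ν {x | t < f x} ≤ q}
  have hS : S.Nonempty := ⟨∞, by simp [S]⟩
  refine ⟨sInf S, ?_, ?_⟩
  · obtain ⟨u, hu, hlim, huS⟩ := exists_seq_tendsto_sInf hS (OrderBot.bddBelow S)
    have h : {x | sInf S < f x} = ⋃ n, {x | u n < f x} := by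
      ext x
      simp only [Set.mem_ofPred_eq, Set.mem_iUnion]
      exact ⟨fun hx => (hlim.eventually_lt_const hx).exists,
        fun ⟨n, hn⟩ => (sInf_le (huS n)).trans_lt hn⟩
    have hmono : Monotone fun n => {x | u n < f x} := fun m n hmn x hx => (hu hmn).trans_lt hx
    rw [h, hmono.measure_iUnion]
    exact iSup_le huS
  · rcases eq_or_ne (sInf S) 0 with h0 | h0
    · simpa [h0] using hq
    obtain ⟨u, hu, hmem, hlim⟩ := exists_seq_strictMono_tendsto' (pos_iff_ne_zero.2 h0)
    have h : {x | sInf S ≤ f x} = ⋂ n, {x | u n < f x} := by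
      ext x
      simp only [Set.mem_ofPred_eq, Set.mem_iInter]
      exact ⟨fun hx n => (hmem n).2.trans_le hx,
        fun hx => le_of_tendsto hlim (.of_forall fun n => (hx n).le)⟩
    have hanti : Antitone fun n => {x | u n < f x} :=
      fun m n hmn x hx => (hu.monotone hmn).trans_lt hx
    rw [h, hanti.measure_iInter
      (fun n => (measurableSet_lt measurable_const hf).nullMeasurableSet)
      ⟨0, measure_ne_top _ _⟩]
    refine le_iInf fun n => ?_
    by_contra! hn
    exact (sInf_le (show u n ∈ S from hn.le)).not_gt (hmem n).2

/-- Sierpiński's theorem for atomless finite measures on standard Borel spaces. -/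
theorem exists_measurableSet_between_measure_eq {X : Type*} [MeasurableSpace X]
    [StandardBorelSpace X] (ν : Measure X) [IsFiniteMeasure ν] [NullSingletonClass ν] {C D : Set X}
    (hC : MeasurableSet C) (hD : MeasurableSet D) (hCD : C ⊆ D) {q : ℝ≥0∞}
    (hCq : ν C ≤ q) (hqD : q ≤ ν D) :
    ∃ B, MeasurableSet B ∧ C ⊆ B ∧ B ⊆ D ∧ ν B = q := by
  set F : X → ℝ≥0∞ := fun x => ENNReal.ofReal (Real.exp (embeddingReal X x))
  have hF : Measurable F := (Real.measurable_exp.comp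
    (measurableEmbedding_embeddingReal X).measurable).ennreal_ofReal
  have hinj : Function.Injective F := fun x y hxy =>
    (measurableEmbedding_embeddingReal X).injective (Real.exp_injective
      ((ENNReal.ofReal_eq_ofReal_iff (Real.exp_pos _).le (Real.exp_pos _).le).1 hxy))
  have hdiff : ν (D \ C) = ν D - ν C := measure_sdiff hCD hC.nullMeasurableSet (measure_ne_top _ _)
  obtain ⟨c, hc1, hc2⟩ := exists_measure_lt_le_measure_le (ν.restrict (D \ C)) hF
    (q := q - ν C) (by simpa [hdiff] using tsub_le_tsub_right hqD _)
  have hm : MeasurableSet {x | c < F x} := measurableSet_lt measurable_const hF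
  have hnull : ν.restrict (D \ C) {x | F x = c} = 0 :=
    Set.Subsingleton.measure_zero (fun x hx y hy => hinj (hx.trans hy.symm)) _
  have hle : ν.restrict (D \ C) {x | c ≤ F x} ≤ ν.restrict (D \ C) {x | c < F x} := by
    calc ν.restrict (D \ C) {x | c ≤ F x}
        ≤ ν.restrict (D \ C) ({x | c < F x} ∪ {x | F x = c}) :=
          measure_mono fun x hx =>
            (show c ≤ F x from hx).lt_or_eq.imp (fun h => h) fun h => h.symm
      _ ≤ _ := (measure_union_le _ _).trans (by rw [hnull, add_zero])
  have heq := le_antisymm hc1 (hc2.trans hle)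
  rw [Measure.restrict_apply hm] at heq
  refine ⟨C ∪ ({x | c < F x} ∩ (D \ C)), hC.union (hm.inter (hD.diff hC)),
    Set.subset_union_left, Set.union_subset hCD fun x hx => hx.2.1, ?_⟩
  rw [measure_union (Set.disjoint_left.2 fun x hx hx' => hx'.2.2 hx) (hm.inter (hD.diff hC)), heq]
  exact add_tsub_cancel_of_le hCq

/-- A Neyman–Pearson lemma: a test of size at most `q` with respect to an atomless measure `π`
is dominated in power by a set of `π`-measure exactly `q`. -/
theorem exists_measurableSet_lintegral_le_measure {X : Type*} [MeasurableSpace X]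
    [StandardBorelSpace X] (μ π : Measure X) [IsFiniteMeasure μ] [IsFiniteMeasure π]
    [NullSingletonClass π] {g : X → ℝ≥0∞} (hg : Measurable g) (hg1 : ∀ x, g x ≤ 1)
    {q : ℝ≥0∞} (hgq : ∫⁻ x, g x ∂π ≤ q) (hq : q ≤ π Set.univ) :
    ∃ B, MeasurableSet B ∧ π B = q ∧ ∫⁻ x, g x ∂μ ≤ μ B := by
  set f := μ.rnDeriv π
  have hf : Measurable f := Measure.measurable_rnDeriv μ π
  obtain ⟨N, hN, hsN, hπN⟩ := Measure.mutuallySingular_singularPart μ π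
  obtain ⟨c, hc1, hc2⟩ := exists_measure_lt_le_measure_le π hf hq
  obtain ⟨B, hB, hCB, hBD, hBq⟩ := exists_measurableSet_between_measure_eq π
    (measurableSet_lt measurable_const hf) (measurableSet_le measurable_const hf)
    (fun x (hx : c < f x) => show c ≤ f x from hx.le) hc1 hc2
  have hcompl : ∫⁻ x in Bᶜ, g x ∂π ≤ ∫⁻ x in B, (1 - g x) ∂π := by
    have h1 : ∫⁻ x in B, g x ∂π + ∫⁻ x in B, (1 - g x) ∂π = q := by
      rw [← lintegral_add_left hg, ← hBq, ← setLIntegral_one]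
      exact lintegral_congr fun x => add_tsub_cancel_of_le (hg1 x)
    have h2 := lintegral_add_compl g hB (μ := π)
    have hfin : ∫⁻ x in B, g x ∂π ≠ ∞ :=
      ne_top_of_le_ne_top (measure_ne_top π B) (by
        rw [← setLIntegral_one]; exact lintegral_mono hg1)
    rw [← ENNReal.add_le_add_iff_left hfin, h1, h2]
    exact hgq
  have hg' : Measurable fun x => 1 - g x := measurable_const.sub hg
  have hac : ∫⁻ x, f x * g x ∂π ≤ ∫⁻ x in B, f x ∂π := by
    calc ∫⁻ x, f x * g x ∂π
        = ∫⁻ x in B, f x * g x ∂π + ∫⁻ x in Bᶜ, f x * g x ∂π := (lintegral_add_compl _ hB).symm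
      _ ≤ ∫⁻ x in B, f x * g x ∂π + ∫⁻ x in Bᶜ, c * g x ∂π := by
          refine add_le_add_right (setLIntegral_mono (hg.const_mul c) fun x hx => ?_) _
          gcongr
          exact not_lt.1 fun h => hx (hCB h)
      _ ≤ ∫⁻ x in B, f x * g x ∂π + ∫⁻ x in B, c * (1 - g x) ∂π := by
          rw [lintegral_const_mul _ hg, lintegral_const_mul _ hg']
          gcongr
      _ ≤ ∫⁻ x in B, f x * g x ∂π + ∫⁻ x in B, f x * (1 - g x) ∂π := by
          refine add_le_add_right (setLIntegral_mono (hf.mul hg') fun x hx => ?_) _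
          exact mul_le_mul_left (show c ≤ f x from hBD hx) _
      _ = ∫⁻ x in B, f x ∂π := by
          refine (lintegral_add_left (hf.mul hg) _).symm.trans (lintegral_congr fun x => ?_)
          rw [Pi.mul_apply, ← mul_add, add_tsub_cancel_of_le (hg1 x), mul_one]
  have hdecomp : μ = μ.singularPart π + π.withDensity f := μ.haveLebesgueDecomposition_add π
  refine ⟨B ∪ Nᶜ, hB.union hN.compl, ?_, ?_⟩
  · refine le_antisymm ((measure_union_le _ _).trans (by rw [hπN, add_zero, hBq])) ?_
    rw [← hBq]
    exact measure_mono Set.subset_union_left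
  · calc ∫⁻ x, g x ∂μ = ∫⁻ x, g x ∂(μ.singularPart π) + ∫⁻ x, g x ∂(π.withDensity f) := by
          conv_lhs => rw [hdecomp]
          exact lintegral_add_measure _ _ _
      _ ≤ μ.singularPart π (B ∪ Nᶜ) + π.withDensity f (B ∪ Nᶜ) := by
          gcongr ?_ + ?_
          · calc ∫⁻ x, g x ∂(μ.singularPart π) ≤ ∫⁻ _, 1 ∂(μ.singularPart π) := lintegral_mono hg1
              _ = μ.singularPart π Set.univ := by simp
              _ = μ.singularPart π (N ∪ Nᶜ) := by rw [Set.union_compl_self]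
              _ ≤ μ.singularPart π Nᶜ := (measure_union_le _ _).trans (by rw [hsN, zero_add])
              _ ≤ _ := measure_mono Set.subset_union_right
          · rw [lintegral_withDensity_eq_lintegral_mul _ hf hg]
            refine hac.trans ?_
            rw [← withDensity_apply _ hB]
            exact measure_mono Set.subset_union_left
      _ = μ (B ∪ Nᶜ) := by
          conv_rhs => rw [hdecomp]
          rfl

/-- The square-root contraction estimate behind the conductance bound. -/
theorem sqrt_one_sub_add_sqrt_one_add_le {x δ : ℝ} (hx : 0 ≤ x) (hx2 : x ≤ 1 / 2) (hδ : 0 ≤ δ)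
    (hδx : δ ≤ x / 16) :
    √(1 - 2 * (1 - δ) * x) + √(1 + 2 * (1 + δ) * x) ≤ 2 * (1 - x ^ 2 / 8) := by
  have hu : 0 ≤ 1 - 2 * (1 - δ) * x := by nlinarith [mul_nonneg hδ hx]
  have hv : 0 ≤ 1 + 2 * (1 + δ) * x := by positivity
  have hxx : x ^ 2 ≤ 1 / 4 := by nlinarith
  have hδx2 : δ * x ≤ x ^ 2 / 16 := by nlinarith
  have hδ2 : (δ * x) ^ 2 ≤ x ^ 2 / 16 := by
    have : (δ * x) ^ 2 ≤ (x ^ 2 / 16) ^ 2 := by gcongr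
    nlinarith [sq_nonneg x]
  have hprod : √(1 - 2 * (1 - δ) * x) * √(1 + 2 * (1 + δ) * x) ≤ 1 - x ^ 2 := by
    rw [← Real.sqrt_mul hu]
    refine Real.sqrt_le_iff.2 ⟨by linarith, ?_⟩
    nlinarith [sq_nonneg (x ^ 2), sq_nonneg x]
  refine (sq_le_sq₀ (by positivity) (by nlinarith)).1 ?_
  nlinarith [Real.sq_sqrt hu, Real.sq_sqrt hv, sq_nonneg (x ^ 2), sq_nonneg x]

/-- Every test of size at most `q` has power at most `q + h(q)`. -/
theorem toReal_lintegral_le_add_hGap {d : ℕ} {Ω : Set (EuclideanSpace ℝ (Fin d))}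
    (hΩ : MeasurableSet Ω) (μ π : Measure (EuclideanSpace ℝ (Fin d))) [IsProbabilityMeasure μ]
    [IsProbabilityMeasure π] [NullSingletonClass π] (hμ : μ Ωᶜ = 0) (hπ : π Ωᶜ = 0)
    {g : EuclideanSpace ℝ (Fin d) → ℝ≥0∞} (hg : Measurable g) (hg1 : ∀ x, g x ≤ 1) {q : ℝ}
    (hq : 0 ≤ q) (hgq : ∫⁻ x, g x ∂π ≤ ENNReal.ofReal q) :
    (∫⁻ x, g x ∂μ).toReal ≤ q + hGap μ π Ω q := by
  rcases le_or_gt q 1 with hq1 | hq1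
  · obtain ⟨B, hB, hBq, hgB⟩ := exists_measurableSet_lintegral_le_measure μ π hg hg1 hgq
      (by simpa using hq1)
    have hμB : μ (B ∩ Ω) = μ B := measure_inter_conull hμ
    have hπB : π (B ∩ Ω) = π B := measure_inter_conull hπ
    have hbdd : BddAbove {x : ℝ | ∃ A : Set (EuclideanSpace ℝ (Fin d)), MeasurableSet A ∧ A ⊆ Ω ∧
        (π A).toReal = q ∧ x = (μ A).toReal - (π A).toReal} := by
      refine ⟨1, ?_⟩
      rintro x ⟨A, -, -, -, rfl⟩
      have h1 : μ.real A ≤ 1 := measureReal_le_one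
      rw [Measure.real] at h1
      linarith [ENNReal.toReal_nonneg (a := π A)]
    have hπq : (π (B ∩ Ω)).toReal = q := by rw [hπB, hBq, ENNReal.toReal_ofReal hq]
    have h := le_csSup hbdd ⟨B ∩ Ω, hB.inter hΩ, Set.inter_subset_right, hπq, rfl⟩
    rw [hπq, hμB] at h
    have h2 := ENNReal.toReal_mono (measure_ne_top μ B) hgB
    change _ ≤ q + sSup _
    linarith
  · have hempty : {x : ℝ | ∃ A : Set (EuclideanSpace ℝ (Fin d)), MeasurableSet A ∧ A ⊆ Ω ∧
        (π A).toReal = q ∧ x = (μ A).toReal - (π A).toReal} = ∅ := by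
      refine Set.eq_empty_of_forall_notMem ?_
      rintro x ⟨A, -, -, hA, -⟩
      have h1 : π.real A ≤ 1 := measureReal_le_one
      rw [Measure.real] at h1
      linarith
    have h1 : ∫⁻ x, g x ∂μ ≤ 1 := (lintegral_mono hg1).trans (by simp)
    have h2 := ENNReal.toReal_mono ENNReal.one_ne_top h1
    rw [ENNReal.toReal_one] at h2
    rw [hGap, hempty, Real.sSup_empty]
    linarith

theorem isProbabilityMeasure_chainDist {d : ℕ}
    (T : Kernel (EuclideanSpace ℝ (Fin d)) (EuclideanSpace ℝ (Fin d))) [IsMarkovKernel T]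
    (μ0 : Measure (EuclideanSpace ℝ (Fin d))) [IsProbabilityMeasure μ0] (k : ℕ) :
    IsProbabilityMeasure (chainDist T μ0 k) := by
  induction k with
  | zero => assumption
  | succ k ih =>
    refine ⟨?_⟩
    change (chainDist T μ0 k).bind T Set.univ = 1
    rw [Measure.bind_apply .univ T.measurable.aemeasurable]
    simp

theorem chainDist_compl_eq_zero {d : ℕ} {Ω : Set (EuclideanSpace ℝ (Fin d))}
    (hΩ : MeasurableSet Ω) (T : Kernel (EuclideanSpace ℝ (Fin d)) (EuclideanSpace ℝ (Fin d)))
    (hT : ∀ u ∈ Ω, T u Ωᶜ = 0) (μ0 : Measure (EuclideanSpace ℝ (Fin d))) (hμ0 : μ0 Ωᶜ = 0)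
    (k : ℕ) : chainDist T μ0 k Ωᶜ = 0 := by
  induction k with
  | zero => exact hμ0
  | succ k ih =>
    change (chainDist T μ0 k).bind T Ωᶜ = 0
    rw [Measure.bind_apply hΩ.compl T.measurable.aemeasurable,
      lintegral_eq_zero_iff (T.measurable_coe hΩ.compl)]
    filter_upwards [measure_eq_zero_iff_ae_notMem.1 ih] with u hu
    exact hT u (not_not.1 hu)

theorem conductance_le {d : ℕ}
    (T : Kernel (EuclideanSpace ℝ (Fin d)) (EuclideanSpace ℝ (Fin d)))
    {Ω A : Set (EuclideanSpace ℝ (Fin d))} (π : Measure (EuclideanSpace ℝ (Fin d)))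
    (hA : MeasurableSet A) (hAΩ : A ⊆ Ω) (h0 : 0 < π A) (h1 : π A < 1) :
    conductance T Ω π ≤
      (∫ u in A, (T u (Ω \ A)).toReal ∂π) / min (π A).toReal (π (Ω \ A)).toReal := by
  refine csInf_le ⟨0, ?_⟩ ⟨A, hA, hAΩ, h0, h1, rfl⟩
  rintro r ⟨B, -, -, -, -, rfl⟩
  positivity

/-- A `1/2`-lazy transition enters a set not containing the current state with probability at most
`1/2`. -/
theorem two_mul_kernel_le_one {X : Type*} [MeasurableSpace X]
    [MeasurableSingletonClass X] (T : Kernel X X) [IsMarkovKernel T] {B : Set X}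
    (hB : MeasurableSet B) {u : X} (hu : u ∉ B) (hlazy : (2⁻¹ : ℝ≥0∞) ≤ T u {u}) :
    2 * T u B ≤ 1 := by
  have h : T u {u} + T u B ≤ 1 := by
    rw [← measure_union (Set.disjoint_singleton_left.2 hu) hB]
    exact prob_le_one
  have h2 : T u B ≤ 2⁻¹ := by
    have h3 : 2⁻¹ + T u B ≤ 2⁻¹ + 2⁻¹ := by
      rw [ENNReal.inv_two_add_inv_two]
      exact (add_le_add_left hlazy _).trans h
    exact (ENNReal.add_le_add_iff_left (by simp)).1 h3
  calc 2 * T u B ≤ 2 * 2⁻¹ := by gcongr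
    _ = 1 := ENNReal.mul_inv_cancel (by simp) (by simp)

/-- If a chain stays put with probability at least `1/2`, the flow out of `A` is at most half the
measure of `A`. -/
theorem two_mul_setLIntegral_le_measure {X : Type*} [MeasurableSpace X]
    [MeasurableSingletonClass X] (T : Kernel X X) [IsMarkovKernel T] (π : Measure X) {A B : Set X}
    (hB : MeasurableSet B) (hAB : Disjoint A B)
    (hlazy : ∀ u ∈ A, (2⁻¹ : ℝ≥0∞) ≤ T u {u}) :
    2 * ∫⁻ u in A, T u B ∂π ≤ π A := by
  rw [← lintegral_const_mul _ (T.measurable_coe hB), ← setLIntegral_one]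
  refine setLIntegral_mono measurable_const fun u hu => ?_
  exact two_mul_kernel_le_one T hB (fun h => Set.disjoint_left.1 hAB hu h) (hlazy u hu)

theorem statement8 {d : ℕ}
    (Ω : Set (EuclideanSpace ℝ (Fin d))) (hΩ : MeasurableSet Ω)
    (Tstar T : Kernel (EuclideanSpace ℝ (Fin d)) (EuclideanSpace ℝ (Fin d)))
    [IsMarkovKernel Tstar] [IsMarkovKernel T]
    (hTstarSupp : ∀ u ∈ Ω, Tstar u Ωᶜ = 0)
    (hTSupp : ∀ u ∈ Ω, T u Ωᶜ = 0)
    (hTstarLazy : ∀ u ∈ Ω, (2⁻¹ : ℝ≥0∞) ≤ Tstar u {u})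
    (hTLazy : ∀ u ∈ Ω, (2⁻¹ : ℝ≥0∞) ≤ T u {u})
    (πs : Measure (EuclideanSpace ℝ (Fin d))) [IsProbabilityMeasure πs]
    (hπsSupp : πs Ωᶜ = 0)
    (hrev : ∀ A B : Set (EuclideanSpace ℝ (Fin d)), MeasurableSet A → MeasurableSet B →
      ∫⁻ u in A, Tstar u B ∂πs = ∫⁻ u in B, Tstar u A ∂πs)
    (hstat : ∀ A : Set (EuclideanSpace ℝ (Fin d)), MeasurableSet A →
      ∫⁻ u, Tstar u A ∂πs = πs A)
    (hatomfree : ∀ u, πs {u} = 0)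
    (δ : ℝ) (hδ0 : 0 ≤ δ)
    (hδ : δ ≤ min (1 - Real.sqrt 2 / 2) (conductance Tstar Ω πs / 16))
    (hclose : ∀ u ∈ Ω, ∀ A : Set (EuclideanSpace ℝ (Fin d)), MeasurableSet A → A ⊆ Ω →
      ENNReal.ofReal (1 - δ) * Tstar u A ≤ T u A ∧ T u A ≤ ENNReal.ofReal (1 + δ) * Tstar u A)
    (μ0 : Measure (EuclideanSpace ℝ (Fin d))) [IsProbabilityMeasure μ0]
    (hμ0Supp : μ0 Ωᶜ = 0) :
    ∀ k : ℕ, 1 ≤ k → ∀ A : Set (EuclideanSpace ℝ (Fin d)), MeasurableSet A → A ⊆ Ω →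
      ∀ p : ℝ, (πs A).toReal = p → 0 < p → p < 1 →
      ∃ φk φtk φhk : ℝ,
        conductance Tstar Ω πs ≤ φk ∧
        2 * (1 - δ) * φk ≤ φtk ∧ φtk ≤ φhk ∧ φhk ≤ 2 * (1 + δ) * φk ∧
        Real.sqrt (1 - φtk) + Real.sqrt (1 + φhk) ≤ 2 * (1 - φk ^ 2 / 8) ∧
        ((chainDist T μ0 k) A).toReal - (πs A).toReal ≤
          (1 / 2) * hGap (chainDist T μ0 (k - 1)) πs Ω (p - φtk * min p (1 - p)) +
          (1 / 2) * hGap (chainDist T μ0 (k - 1)) πs Ω (p + φhk * min p (1 - p)) +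
          2 * δ * φk * Real.sqrt (min p (1 - p)) := by
  intro k hk A hA hAΩ p hp hp0 hp1
  obtain ⟨k, rfl⟩ := Nat.exists_eq_add_of_le' hk
  rw [Nat.add_sub_cancel]
  have : NullSingletonClass πs := ⟨hatomfree⟩
  set μ := chainDist T μ0 k
  have : IsProbabilityMeasure μ := isProbabilityMeasure_chainDist T μ0 k
  have hμ : μ Ωᶜ = 0 := chainDist_compl_eq_zero hΩ T hTSupp μ0 hμ0Supp k
  have hAc : MeasurableSet (Ω \ A) := hΩ.diff hA
  have hpA : πs A = ENNReal.ofReal p := by rw [← hp, ENNReal.ofReal_toReal (measure_ne_top _ _)]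
  have hpAc : πs (Ω \ A) = ENNReal.ofReal (1 - p) := by
    rw [measure_sdiff hAΩ hA.nullMeasurableSet (measure_ne_top _ _), hpA,
      (prob_compl_eq_zero_iff hΩ).1 hπsSupp, ENNReal.ofReal_sub _ hp0.le, ENNReal.ofReal_one]
  set Φ : ℝ := (∫⁻ u in A, Tstar u (Ω \ A) ∂πs).toReal with hΦ
  have hΦfin : ∫⁻ u in A, Tstar u (Ω \ A) ∂πs ≠ ∞ :=
    ne_top_of_le_ne_top (measure_ne_top πs A) (by
      rw [← setLIntegral_one]
      exact lintegral_mono fun u => prob_le_one)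
  have hΦ0 : 0 ≤ Φ := ENNReal.toReal_nonneg
  have hflow : ∫⁻ u in A, Tstar u (Ω \ A) ∂πs = ENNReal.ofReal Φ :=
    (ENNReal.ofReal_toReal hΦfin).symm
  have hflow' : ∫⁻ u in Ω \ A, Tstar u A ∂πs = ENNReal.ofReal Φ := by
    rw [← hflow, hrev A (Ω \ A) hA hAc]
  have hΦp : 2 * Φ ≤ p := by
    have h := two_mul_setLIntegral_le_measure Tstar πs hAc Set.disjoint_sdiff_right
      fun u hu => hTstarLazy u (hAΩ hu)
    rw [hflow, hpA, ← ENNReal.ofReal_ofNat 2, ← ENNReal.ofReal_mul (by norm_num)] at h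
    exact (ENNReal.ofReal_le_ofReal_iff hp0.le).1 h
  have hΦp' : 2 * Φ ≤ 1 - p := by
    have h := two_mul_setLIntegral_le_measure Tstar πs hA Set.disjoint_sdiff_left
      fun u hu => hTstarLazy u hu.1
    rw [hflow', hpAc, ← ENNReal.ofReal_ofNat 2, ← ENNReal.ofReal_mul (by norm_num)] at h
    exact (ENNReal.ofReal_le_ofReal_iff (by linarith)).1 h
  set Γ : ℝ := min p (1 - p)
  have hΓ0 : 0 < Γ := lt_min hp0 (by linarith)
  have hΓ1 : Γ ≤ 1 := (min_le_left _ _).trans hp1.le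
  set x : ℝ := Φ / Γ
  have hx0 : 0 ≤ x := by positivity
  have hxΓ : x * Γ = Φ := div_mul_cancel₀ _ hΓ0.ne'
  have hx2 : x ≤ 1 / 2 := by
    have h : 2 * Φ ≤ Γ := le_min hΦp hΦp'
    rw [div_le_iff₀ hΓ0]
    linarith
  have hcond : conductance Tstar Ω πs ≤ x := by
    have h := conductance_le Tstar πs hA hAΩ (by simpa [hpA] using hp0) (by simpa [hpA] using hp1)
    rwa [hp, hpAc, ENNReal.toReal_ofReal (by linarith),
      integral_toReal (Tstar.measurable_coe hAc).aemeasurable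
        (.of_forall fun u => measure_lt_top _ _)] at h
  have hδx : δ ≤ x / 16 := by linarith [hδ.trans (min_le_right _ _)]
  have hδ1 : δ ≤ 1 := by linarith
  refine ⟨x, 2 * (1 - δ) * x, 2 * (1 + δ) * x, hcond, le_rfl, by nlinarith, le_rfl,
    sqrt_one_sub_add_sqrt_one_add_le hx0 hx2 hδ0 hδx, ?_⟩
  have hq1 : p - 2 * (1 - δ) * x * Γ = p - 2 * (1 - δ) * Φ := by rw [mul_assoc, hxΓ]
  have hq2 : p + 2 * (1 + δ) * x * Γ = p + 2 * (1 + δ) * Φ := by rw [mul_assoc, hxΓ]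
  rw [hq1, hq2, hp]
  have hTA : Measurable fun u => T u A := T.measurable_coe hA
  set g₁ : EuclideanSpace ℝ (Fin d) → ℝ≥0∞ := A.indicator fun u => 1 - 2 * T u (Ω \ A)
  set g₂ : EuclideanSpace ℝ (Fin d) → ℝ≥0∞ :=
    A.indicator 1 + (Ω \ A).indicator fun u => 2 * T u A
  have hg₁ : Measurable g₁ :=
    (measurable_const.sub ((T.measurable_coe hAc).const_mul 2)).indicator hA
  have hg₂ : Measurable g₂ :=
    (measurable_one.indicator hA).add ((hTA.const_mul 2).indicator hAc)
  have hout : ∀ u ∈ A, 2 * T u (Ω \ A) ≤ 1 := fun u hu =>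
    two_mul_kernel_le_one T hAc (fun h => h.2 hu) (hTLazy u (hAΩ hu))
  have hin : ∀ u ∈ Ω \ A, 2 * T u A ≤ 1 := fun u hu =>
    two_mul_kernel_le_one T hA hu.2 (hTLazy u hu.1)
  have hg₁1 : ∀ u, g₁ u ≤ 1 := fun u => by
    by_cases hu : u ∈ A <;> simp [g₁, hu]
  have hg₂1 : ∀ u, g₂ u ≤ 1 := fun u => by
    by_cases hu : u ∈ A
    · simp [g₂, hu]
    · by_cases hu' : u ∈ Ω
      · simpa [g₂, hu, hu'] using hin u ⟨hu', hu⟩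
      · simp [g₂, hu, hu']
  have hint₁ : ∫⁻ u, g₁ u ∂πs ≤ ENNReal.ofReal (p - 2 * (1 - δ) * Φ) := by
    have h1 : ∫⁻ u, g₁ u ∂πs + 2 * ∫⁻ u in A, T u (Ω \ A) ∂πs = ENNReal.ofReal p := by
      rw [lintegral_indicator hA, ← lintegral_const_mul _ (T.measurable_coe hAc),
        ← lintegral_add_right _ ((T.measurable_coe hAc).const_mul 2), ← hpA, ← setLIntegral_one]
      exact setLIntegral_congr_fun hA fun u hu => tsub_add_cancel_of_le (hout u hu)
    have h2 : ENNReal.ofReal (2 * (1 - δ) * Φ) ≤ 2 * ∫⁻ u in A, T u (Ω \ A) ∂πs := by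
      rw [mul_assoc, ENNReal.ofReal_mul (by norm_num), ENNReal.ofReal_mul (by linarith), ← hflow,
        ENNReal.ofReal_ofNat, ← lintegral_const_mul _ (Tstar.measurable_coe hAc)]
      gcongr 2 * ?_
      exact setLIntegral_mono (T.measurable_coe hAc) fun u hu =>
        (hclose u (hAΩ hu) _ hAc Set.sdiff_subset).1
    rw [ENNReal.ofReal_sub _ (by nlinarith), ← h1]
    exact ENNReal.le_sub_of_add_le_right ENNReal.ofReal_ne_top (by gcongr)
  have hint₂ : ∫⁻ u, g₂ u ∂πs ≤ ENNReal.ofReal (p + 2 * (1 + δ) * Φ) := by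
    have h2 : 2 * ∫⁻ u in Ω \ A, T u A ∂πs ≤ ENNReal.ofReal (2 * (1 + δ) * Φ) := by
      rw [mul_assoc, ENNReal.ofReal_mul (by norm_num), ENNReal.ofReal_mul (by linarith), ← hflow',
        ENNReal.ofReal_ofNat, ← lintegral_const_mul _ (Tstar.measurable_coe hA)]
      gcongr 2 * ?_
      exact setLIntegral_mono ((Tstar.measurable_coe hA).const_mul _) fun u hu =>
        (hclose u hu.1 _ hA hAΩ).2
    rw [ENNReal.ofReal_add hp0.le (by nlinarith), ← hpA]
    calc ∫⁻ u, g₂ u ∂πs = πs A + 2 * ∫⁻ u in Ω \ A, T u A ∂πs := by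
          rw [← lintegral_const_mul _ hTA, ← lintegral_indicator_one hA,
            ← lintegral_indicator hAc, ← lintegral_add_left (measurable_one.indicator hA)]
          rfl
      _ ≤ _ := by gcongr
  have hsum : ∫⁻ u, g₁ u ∂μ + ∫⁻ u, g₂ u ∂μ = 2 * chainDist T μ0 (k + 1) A := by
    change _ = 2 * μ.bind T A
    rw [Measure.bind_apply hA T.measurable.aemeasurable, ← lintegral_add_left hg₁,
      ← lintegral_const_mul _ hTA]
    refine lintegral_congr_ae ?_
    filter_upwards [measure_eq_zero_iff_ae_notMem.1 hμ] with u hu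
    have hu : u ∈ Ω := not_not.1 hu
    by_cases huA : u ∈ A
    · have h1 : T u A + T u (Ω \ A) = 1 := by
        rw [← measure_union Set.disjoint_sdiff_right hAc, Set.union_sdiff_cancel hAΩ]
        exact (prob_compl_eq_zero_iff hΩ).1 (hTSupp u hu)
      have h2 : g₁ u + g₂ u = 1 - 2 * T u (Ω \ A) + 1 := by simp [g₁, g₂, huA]
      rw [h2]
      have hne : 2 * T u (Ω \ A) ≠ ∞ := ne_top_of_le_ne_top ENNReal.one_ne_top (hout u huA)
      rw [← ENNReal.add_left_inj hne, add_right_comm, tsub_add_cancel_of_le (hout u huA),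
        ← mul_add, h1]
      norm_num
    · simp [g₁, g₂, huA, hu]
  have hfin : ∀ g : EuclideanSpace ℝ (Fin d) → ℝ≥0∞, (∀ u, g u ≤ 1) → ∫⁻ u, g u ∂μ ≠ ∞ :=
    fun g hg => ne_top_of_le_ne_top ENNReal.one_ne_top ((lintegral_mono hg).trans (by simp))
  have hsum' := congrArg ENNReal.toReal hsum
  rw [ENNReal.toReal_add (hfin _ hg₁1) (hfin _ hg₂1), ENNReal.toReal_mul,
    ENNReal.toReal_ofNat] at hsum'
  have hb₁ := toReal_lintegral_le_add_hGap hΩ μ πs hμ hπsSupp hg₁ hg₁1 (by nlinarith) hint₁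
  have hb₂ := toReal_lintegral_le_add_hGap hΩ μ πs hμ hπsSupp hg₂ hg₂1 (by nlinarith) hint₂
  have herr : 2 * δ * Φ ≤ 2 * δ * x * √Γ := by
    rw [← hxΓ, ← mul_assoc]
    gcongr
    exact Real.le_sqrt_self_iff.2 hΓ1
  linarith
end
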